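/- Let q = 2h+3 with h ≥ 1 be an odd integer, λ = 2cos(π/q), and let α ∈ (α₀, 1/2]. Then T_α^{2h+1}((α−1)λ) = (1−2α)λ/((α−1)λ² + 2λ − 2) and T_α^{2h+1}(αλ) = (2α−1)λ/(2λ − 2 − αλ²). -/

import Mathlib

open Real MeasureTheory Set

/-- The digit function `d_α(x) = ⌊|1/(λx)| + 1 − α⌋`. -/
noncomputable def rosenD (lam a x : ℝ) : ℤ := ⌊|1 / (lam * x)| + 1 - a⌋

/-- The α-Rosen map `T_α`. -/
noncomputable def rosenT (lam a : ℝ) (x : ℝ) : ℝ :=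
  if x = 0 then 0 else |1 / x| - lam * rosenD lam a x

/-- The planar map `𝒯_α(x,y) = (T_α(x), 1/(d_α(x)λ + ε(x)·y))`. -/
noncomputable def rosenTT (lam a : ℝ) (z : ℝ × ℝ) : ℝ × ℝ :=
  (rosenT lam a z.1, 1 / ((rosenD lam a z.1 : ℝ) * lam + Real.sign z.1 * z.2))

/-- If `|1/x| - dλ` lies in `I_α`, then it is `T_α(x)`. -/
theorem rosenT_eq_of_mem {lam a x : ℝ} (hlam : 0 < lam) (hx : x ≠ 0) (d : ℤ)
    (h₁ : (a - 1) * lam ≤ |1 / x| - lam * d) (h₂ : |1 / x| - lam * d < a * lam) :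
    rosenT lam a x = |1 / x| - lam * d := by
  have hd : rosenD lam a x = d := by
    have habs : |1 / (lam * x)| = |1 / x| / lam := by
      rw [mul_comm, ← div_div, abs_div, abs_of_pos hlam]
    have hle : d + a - 1 ≤ |1 / x| / lam := by
      rw [le_div_iff₀ hlam]; linarith
    have hlt : |1 / x| / lam < d + a := by
      rw [div_lt_iff₀ hlam]; linarith
    rw [rosenD, habs, Int.floor_eq_iff]
    constructor <;> linarith
  rw [rosenT, if_neg hx, hd]

/-- The solution of `s (j + 2) = 2 cos θ · s (j + 1) - s j` with `s 0 = B sin θ` and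
`s 1 = A sin θ`. -/
noncomputable def sinSeq (θ A B : ℝ) (j : ℕ) : ℝ :=
  A * sin (j * θ) - B * sin ((j - 1) * θ)

theorem sinSeq_zero (θ A B : ℝ) : sinSeq θ A B 0 = B * sin θ := by
  simp [sinSeq]

theorem sinSeq_one (θ A B : ℝ) : sinSeq θ A B 1 = A * sin θ := by
  simp [sinSeq]

theorem sin_add_one_mul (θ x : ℝ) :
    sin ((x + 1) * θ) = 2 * cos θ * sin (x * θ) - sin ((x - 1) * θ) := by
  rw [add_mul, sub_mul, one_mul, sin_add, sin_sub]
  ring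

theorem sinSeq_add_two (θ A B : ℝ) (j : ℕ) :
    sinSeq θ A B (j + 2) = 2 * cos θ * sinSeq θ A B (j + 1) - sinSeq θ A B j := by
  have h₁ := sin_add_one_mul θ (j + 1)
  have h₂ := sin_add_one_mul θ j
  simp only [sinSeq]
  push_cast
  rw [show (j : ℝ) + 2 = j + 1 + 1 by ring, h₁, add_sub_cancel_right,
    add_sub_cancel_right, h₂]
  ring

/-- A solution of the recurrence which is positive at both ends of a range shorter than a
half-period is positive throughout. -/
theorem sinSeq_pos {θ A B : ℝ} {n : ℕ} (hn : 0 < n) (hθ : 0 < θ) (hnθ : n * θ < π)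
    (hB : 0 < B) (hend : 0 < sinSeq θ A B n) {j : ℕ} (hj : j ≤ n) :
    0 < sinSeq θ A B j := by
  have hj' : (j : ℝ) ≤ n := by exact_mod_cast hj
  have hn' : (1 : ℝ) ≤ n := by exact_mod_cast hn
  have hsn : 0 < sin (n * θ) := sin_pos_of_pos_of_lt_pi (by positivity) hnθ
  have hsθ : 0 < sin θ := sin_pos_of_pos_of_lt_pi hθ (by nlinarith)
  have key : sin (n * θ) * sinSeq θ A B j =
      B * sin θ * sin ((n - j) * θ) + sinSeq θ A B n * sin (j * θ) := by
    simp only [sinSeq, sub_mul, one_mul, sin_sub]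
    ring
  have hsj : 0 ≤ sin (j * θ) :=
    sin_nonneg_of_nonneg_of_le_pi (by positivity) (by nlinarith)
  rcases hj.eq_or_lt with rfl | hlt
  · exact hend
  have hlt' : (j : ℝ) < n := by exact_mod_cast hlt
  have hsnj : 0 < sin ((n - j) * θ) := by
    refine sin_pos_of_pos_of_lt_pi (mul_pos (by linarith) hθ) ?_
    have : 0 ≤ (j : ℝ) * θ := by positivity
    linarith [sub_mul (n : ℝ) j θ]
  refine pos_of_mul_pos_right (a := sin (n * θ)) ?_ hsn.le
  rw [key]
  positivity

/-- Along ratios of consecutive positive terms of `sinSeq`, the map `T_α` acts by shifting the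
index, with all digits equal to one. -/
theorem rosenT_iterate_sinSeq {lam a θ A B : ℝ} (hlam : lam = 2 * cos θ) (hlam0 : 0 < lam)
    (hlam2 : lam < 2) (ha : 0 < a) {k n : ℕ}
    (hstart : (a - 1) * lam ≤ -sinSeq θ A B (k + 1) / sinSeq θ A B k)
    (hpos : ∀ j ≤ k + n, 0 < sinSeq θ A B j)
    (hend : -sinSeq θ A B (k + n + 1) / sinSeq θ A B (k + n) < a * lam) :
    (rosenT lam a)^[n] (-sinSeq θ A B (k + 1) / sinSeq θ A B k) =
        -sinSeq θ A B (k + n + 1) / sinSeq θ A B (k + n) ∧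
      (a - 1) * lam ≤ -sinSeq θ A B (k + n + 1) / sinSeq θ A B (k + n) := by
  induction n with
  | zero => exact ⟨rfl, hstart⟩
  | succ n ih =>
    have p₀ := hpos (k + n) (by omega)
    have p₁ := hpos (k + n + 1) (by omega)
    have hneg : -sinSeq θ A B (k + n + 1) / sinSeq θ A B (k + n) < 0 :=
      div_neg_of_neg_of_pos (by linarith) p₀
    obtain ⟨ih₁, ih₂⟩ := ih (fun j hj => hpos j (by omega)) (hneg.trans (by positivity))
    have hrec := sinSeq_add_two θ A B (k + n)
    rw [← hlam] at hrec
    rw [show k + (n + 1) = k + n + 1 by ring] at hend ⊢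
    rw [show k + n + 1 + 1 = k + n + 2 by ring] at hend ⊢
    have hval : |1 / (-sinSeq θ A B (k + n + 1) / sinSeq θ A B (k + n))| - lam * (1 : ℤ) =
        -sinSeq θ A B (k + n + 2) / sinSeq θ A B (k + n + 1) := by
      rw [abs_of_neg (one_div_neg.2 hneg), hrec]
      push_cast
      field_simp
      ring
    have hmono : -sinSeq θ A B (k + n + 1) / sinSeq θ A B (k + n) ≤
        -sinSeq θ A B (k + n + 2) / sinSeq θ A B (k + n + 1) := by
      rw [div_le_div_iff₀ p₀ p₁, hrec]
      nlinarith [sq_nonneg (sinSeq θ A B (k + n) - sinSeq θ A B (k + n + 1)),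
        mul_pos p₀ p₁]
    refine ⟨?_, ih₂.trans hmono⟩
    rw [Function.iterate_succ_apply', ih₁, rosenT_eq_of_mem hlam0 hneg.ne 1, hval]
    · rw [hval]; exact ih₂.trans hmono
    · rw [hval]; exact hend

/-- Closed forms of `sinSeq` near the middle of the half-period `2 h + 3`. -/
theorem sinSeq_middle {θ lam : ℝ} {h : ℕ} (A B : ℝ) (hθ : (2 * h + 3) * θ = π)
    (hlam : lam = 2 * cos θ) :
    sinSeq θ A B h = sin ((h + 1) * θ) * (A * (lam - 1) - B * (lam ^ 2 - lam - 1)) ∧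
      sinSeq θ A B (h + 1) = sin ((h + 1) * θ) * (A - B * (lam - 1)) ∧
      sinSeq θ A B (h + 2) = sin ((h + 1) * θ) * (A - B) := by
  have e₂ : sin ((h + 2) * θ) = sin ((h + 1) * θ) := by
    rw [← sin_pi_sub, ← hθ]
    ring_nf
  have r₁ := sin_add_one_mul θ (h + 1)
  have r₂ := sin_add_one_mul θ h
  rw [show (h : ℝ) + 1 + 1 = h + 2 by ring, add_sub_cancel_right, e₂, ← hlam] at r₁
  rw [← hlam] at r₂
  have e₀ : sin (h * θ) = sin ((h + 1) * θ) * (lam - 1) := by linarith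
  have e₁ : sin ((h - 1) * θ) = sin ((h + 1) * θ) * (lam ^ 2 - lam - 1) := by
    rw [e₀] at r₂; linarith
  simp only [sinSeq]
  push_cast
  rw [show (h : ℝ) + 2 - 1 = h + 1 by ring, add_sub_cancel_right, e₂, e₀, e₁]
  exact ⟨by ring, by ring, by ring⟩

theorem two_mul_cos_pi_div_bounds {h q : ℕ} {lam : ℝ} (hh : 1 ≤ h) (hq : q = 2 * h + 3)
    (hlam : lam = 2 * cos (π / (q : ℝ))) : 8 / 5 < lam ∧ lam < 2 := by
  have hq5 : (5 : ℝ) ≤ q := by exact_mod_cast (by omega : 5 ≤ q)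
  have hpos : 0 < π / (q : ℝ) := by positivity
  have hle : π / (q : ℝ) ≤ π / 5 := by gcongr
  constructor
  · have hcos : cos (π / 5) ≤ cos (π / (q : ℝ)) :=
      cos_le_cos_of_nonneg_of_le_pi hpos.le (by linarith [pi_pos]) hle
    have h5 : (11 / 5 : ℝ) < √5 := lt_sqrt_of_sq_lt (by norm_num)
    rw [cos_pi_div_five] at hcos
    linarith
  · have : cos (π / (q : ℝ)) < cos 0 :=
      cos_lt_cos_of_nonneg_of_le_pi le_rfl (by linarith [pi_pos]) hpos
    rw [cos_zero] at this
    linarith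

/-- Inequalities which follow from `α₀ < α`. -/
theorem alpha_bounds {lam a : ℝ} (h₁ : 8 / 5 < lam) (h₂ : lam < 2)
    (ha : (lam - 2 + √(2 * lam ^ 2 - 4 * lam + 4)) / lam ^ 2 < a) :
    1 < a ^ 2 * lam ^ 2 + (4 - 2 * lam) * a ∧ lam / 4 < a ∧ 2 * lam - 2 < a * lam ^ 2 ∧
      0 < 1 - (1 - a) * lam := by
  have hlam : 0 < lam ^ 2 := by positivity
  have hrad : 0 ≤ 2 * lam ^ 2 - 4 * lam + 4 := by nlinarith [sq_nonneg (lam - 1)]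
  set s := √(2 * lam ^ 2 - 4 * lam + 4) with hs
  have hs0 : 0 ≤ s := sqrt_nonneg _
  have hs2 : s ^ 2 = 2 * lam ^ 2 - 4 * lam + 4 := sq_sqrt hrad
  rw [div_lt_iff₀ hlam] at ha
  have hsl : lam ≤ s := le_sqrt_of_sq_le (by nlinarith [sq_nonneg (lam - 2)])
  have hs' : lam ^ 2 - 2 * lam + 2 ≤ s := by
    refine le_sqrt_of_sq_le ?_
    nlinarith [mul_nonneg (mul_nonneg (by linarith : 0 ≤ lam) (by linarith : 0 ≤ 2 - lam))
      (by nlinarith [sq_nonneg (lam - 1)] : 0 ≤ lam ^ 2 - 2 * lam + 2)]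
  have hquarter : lam ^ 3 / 4 - lam + 2 ≤ s := by
    refine le_sqrt_of_sq_le ?_
    have : 0 ≤ lam ^ 2 * (2 - lam) * (lam ^ 3 + 2 * lam ^ 2 - 4 * lam + 8) := by
      refine mul_nonneg (mul_nonneg hlam.le (by linarith)) ?_
      nlinarith [pow_pos (by linarith : 0 < lam) 3]
    nlinarith
  refine ⟨?_, ?_, by linarith, ?_⟩
  · have : s ^ 2 < (a * lam ^ 2 + 2 - lam) ^ 2 := by gcongr; linarith
    rw [hs2] at this
    have h3 : 0 < lam ^ 2 * (a ^ 2 * lam ^ 2 + (4 - 2 * lam) * a - 1) := by nlinarith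
    linarith [pos_of_mul_pos_right h3 hlam.le]
  · have h3 : 0 < lam ^ 2 * (a - lam / 4) := by nlinarith
    linarith [pos_of_mul_pos_right h3 hlam.le]
  · have h3 : 0 < lam * (1 - (1 - a) * lam) := by nlinarith
    exact pos_of_mul_pos_right h3 (by linarith)

/-- One digit-two step at the end of a block: the ratio `-sinSeq (n + 1) / sinSeq n` is sent to
`-sinSeq (n + 2) / sinSeq (n + 1) - λ`. -/
theorem rosenT_sinSeq_two {lam a θ A B : ℝ} {n : ℕ} (hlam : lam = 2 * cos θ) (hlam0 : 0 < lam)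
    (p₀ : 0 < sinSeq θ A B n) (p₁ : 0 < sinSeq θ A B (n + 1))
    (h₁ : a * lam ≤ -sinSeq θ A B (n + 2) / sinSeq θ A B (n + 1))
    (h₂ : -sinSeq θ A B (n + 2) / sinSeq θ A B (n + 1) < (1 + a) * lam) :
    rosenT lam a (-sinSeq θ A B (n + 1) / sinSeq θ A B n) =
      -sinSeq θ A B (n + 2) / sinSeq θ A B (n + 1) - lam := by
  have hneg : -sinSeq θ A B (n + 1) / sinSeq θ A B n < 0 :=
    div_neg_of_neg_of_pos (by linarith) p₀
  have hval : |1 / (-sinSeq θ A B (n + 1) / sinSeq θ A B n)| - lam * (2 : ℤ) =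
      -sinSeq θ A B (n + 2) / sinSeq θ A B (n + 1) - lam := by
    rw [abs_of_neg (one_div_neg.2 hneg), sinSeq_add_two, ← hlam]
    push_cast
    field_simp
    ring
  rw [rosenT_eq_of_mem hlam0 hneg.ne 2, hval] <;> rw [hval] <;> linarith

theorem angle_bounds {θ : ℝ} {h : ℕ} (hθ : (2 * h + 3) * θ = π) :
    0 < θ ∧ ((h + 1 : ℕ) : ℝ) * θ < π ∧ 0 < sin θ ∧ 0 < sin ((h + 1) * θ) := by
  have hh0 : (0 : ℝ) ≤ h := Nat.cast_nonneg h
  have hθ0 : 0 < θ := pos_of_mul_pos_right (hθ ▸ pi_pos) (by positivity)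
  have hθn : ((h + 1 : ℕ) : ℝ) * θ < π := by push_cast; nlinarith
  exact ⟨hθ0, hθn, sin_pos_of_pos_of_lt_pi hθ0 (by nlinarith),
    sin_pos_of_pos_of_lt_pi (by positivity) (by exact_mod_cast hθn)⟩

theorem sinSeq_zero_ratio {θ : ℝ} (A B : ℝ) (hθ : 0 < sin θ) :
    -sinSeq θ A B (0 + 1) / sinSeq θ A B 0 = -A / B := by
  rw [zero_add, sinSeq_one, sinSeq_zero, ← neg_mul, mul_div_mul_right _ _ hθ.ne']

theorem sinSeq_middle_ratio {θ lam : ℝ} {h : ℕ} (hθ : (2 * h + 3) * θ = π)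
    (hlam : lam = 2 * cos θ) (A B : ℝ) :
    -sinSeq θ A B (h + 1) / sinSeq θ A B h =
        (B * (lam - 1) - A) / (A * (lam - 1) - B * (lam ^ 2 - lam - 1)) ∧
      -sinSeq θ A B (h + 2) / sinSeq θ A B (h + 1) = (B - A) / (A - B * (lam - 1)) := by
  obtain ⟨m₀, m₁, m₂⟩ := sinSeq_middle A B hθ hlam
  have hc := (angle_bounds hθ).2.2.2.ne'
  rw [m₀, m₁, m₂, ← mul_neg, ← mul_neg, mul_div_mul_left _ _ hc, mul_div_mul_left _ _ hc,
    neg_sub, neg_sub]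
  exact ⟨rfl, rfl⟩

/-- A block of `h` digits equal to one, starting at `-A / B`. -/
theorem rosenT_iterate_block {θ lam a : ℝ} {h : ℕ} (hh : 1 ≤ h) (hθ : (2 * h + 3) * θ = π)
    (hlam : lam = 2 * cos θ) (hl0 : 0 < lam) (h₂ : lam < 2) (ha : 0 < a) {A B : ℝ} (C D : ℝ)
    (hB : 0 < B) (hD : D = A * (lam - 1) - B * (lam ^ 2 - lam - 1))
    (hC : C = B * (lam - 1) - A) (hD0 : 0 < D) (hst : (a - 1) * lam ≤ -A / B)
    (hen : C / D < a * lam) : (rosenT lam a)^[h] (-A / B) = C / D := by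
  obtain ⟨hθ0, hθn, hsθ, hc⟩ := angle_bounds hθ
  have hθh : (h : ℝ) * θ < π := by push_cast at hθn; linarith
  have hmid := (sinSeq_middle A B hθ hlam).1
  have hr := (sinSeq_middle_ratio hθ hlam A B).1
  rw [← hD] at hmid hr
  rw [← hC] at hr
  have hpos : ∀ j ≤ 0 + h, 0 < sinSeq θ A B j := fun j hj =>
    sinSeq_pos hh hθ0 hθh hB (by rw [hmid]; positivity) (by simpa using hj)
  have := (rosenT_iterate_sinSeq hlam hl0 h₂ ha (A := A) (B := B) (k := 0) (n := h)
    (by rw [sinSeq_zero_ratio _ _ hsθ]; exact hst) hpos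
    (by rw [zero_add, hr]; exact hen)).1
  rwa [sinSeq_zero_ratio _ _ hsθ, zero_add, hr] at this

/-- The orbit of the left endpoint of `I_α`: its digits up to time `2 h + 1` are all equal to one,
except the one at time `h + 1`, which is two. -/
theorem rosenT_iterate_left_endpoint {θ lam a : ℝ} {h : ℕ}
    (hh : 1 ≤ h) (hθ : (2 * h + 3) * θ = π)
    (hlam : lam = 2 * cos θ) (h₁ : 8 / 5 < lam) (h₂ : lam < 2)
    (ha0 : (lam - 2 + √(2 * lam ^ 2 - 4 * lam + 4)) / lam ^ 2 < a) (ha1 : a ≤ 1 / 2) :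
    (rosenT lam a)^[2 * h + 1] ((a - 1) * lam) =
      (1 - 2 * a) * lam / ((a - 1) * lam ^ 2 + 2 * lam - 2) := by
  obtain ⟨hθ0, hθn, hsθ, hc⟩ := angle_bounds hθ
  obtain ⟨hquad, hlow, hden, hq1⟩ := alpha_bounds h₁ h₂ ha0
  have hl0 : 0 < lam := by linarith
  have ha : 0 < a := by linarith
  have hal : a * lam < 1 := by nlinarith
  have hal0 : 0 < a * lam := by positivity
  have hp1 : 0 < 1 - a * lam := by linarith
  have hpos : ∀ j ≤ h + 1, 0 < sinSeq θ ((1 - a) * lam) 1 j := fun j hj =>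
    sinSeq_pos (by omega) hθ0 hθn one_pos
      (by rw [(sinSeq_middle _ _ hθ hlam).2.1]; exact mul_pos hc (by linarith)) hj
  have hx : (a - 1) * lam = -((1 - a) * lam) / 1 := by ring
  have hfirst := (rosenT_iterate_sinSeq hlam hl0 h₂ ha (A := (1 - a) * lam) (B := 1) (k := 0)
    (n := h) (by rw [sinSeq_zero_ratio _ _ hsθ, ← hx]) (fun j hj => hpos j (by omega))
    (by
      rw [zero_add]
      exact (div_neg_of_neg_of_pos (by linarith [hpos (h + 1) le_rfl])
        (hpos h (by omega))).trans hal0)).1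
  rw [sinSeq_zero_ratio _ _ hsθ, ← hx, zero_add] at hfirst
  have hr₂ := (sinSeq_middle_ratio hθ hlam ((1 - a) * lam) 1).2
  rw [show (1 - a) * lam - 1 * (lam - 1) = 1 - a * lam by ring] at hr₂
  have b₁ : a * lam ≤ (1 - (1 - a) * lam) / (1 - a * lam) := by
    rw [le_div_iff₀ hp1]; nlinarith
  have b₂ : (1 - (1 - a) * lam) / (1 - a * lam) < (1 + a) * lam := by
    rw [div_lt_iff₀ hp1]; nlinarith
  have htwo := rosenT_sinSeq_two (a := a) hlam hl0 (hpos h (by omega)) (hpos (h + 1) le_rfl)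
    (by rw [hr₂]; exact b₁) (by rw [hr₂]; exact b₂)
  have hy : (1 - (1 - a) * lam) / (1 - a * lam) - lam =
      -(2 * lam - a * lam ^ 2 - 1 - a * lam) / (1 - a * lam) := by
    field_simp; ring
  rw [hr₂, hy] at htwo
  have hD : 0 < (1 - a) * lam ^ 2 - 2 * lam + 2 := by nlinarith
  rw [show 2 * h + 1 = h + (h + 1) by ring, Function.iterate_add_apply,
    Function.iterate_succ_apply', hfirst, htwo,
    rosenT_iterate_block hh hθ hlam hl0 h₂ ha (-((1 - 2 * a) * lam))
      ((1 - a) * lam ^ 2 - 2 * lam + 2) hp1 (by ring) (by ring) hD (by rw [← hy]; linarith) ?_]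
  · rw [← neg_div_neg_eq, neg_neg]
    ring_nf
  · refine lt_of_le_of_lt (div_nonpos_of_nonpos_of_nonneg ?_ hD.le) hal0
    nlinarith

/-- The orbit of the right endpoint of `I_α`: its digits up to time `2 h + 1` are all equal to one,
except the one at time `h + 1`, which is two. -/
theorem rosenT_iterate_right_endpoint {θ lam a : ℝ} {h : ℕ}
    (hh : 1 ≤ h) (hθ : (2 * h + 3) * θ = π)
    (hlam : lam = 2 * cos θ) (h₁ : 8 / 5 < lam) (h₂ : lam < 2)
    (ha0 : (lam - 2 + √(2 * lam ^ 2 - 4 * lam + 4)) / lam ^ 2 < a) (ha1 : a ≤ 1 / 2) :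
    (rosenT lam a)^[2 * h + 1] (a * lam) =
      (2 * a - 1) * lam / (2 * lam - 2 - a * lam ^ 2) := by
  obtain ⟨hθ0, hθn, hsθ, hc⟩ := angle_bounds hθ
  obtain ⟨hquad, hlow, hden, hq1⟩ := alpha_bounds h₁ h₂ ha0
  have hl0 : 0 < lam := by linarith
  have ha : 0 < a := by linarith
  have hal : a * lam < 1 := by nlinarith
  have hal0 : 0 < a * lam := by positivity
  have hpos : ∀ j ≤ h + 1, 0 < sinSeq θ (a * lam) 1 j := fun j hj =>
    sinSeq_pos (by omega) hθ0 hθn one_pos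
      (by rw [(sinSeq_middle _ _ hθ hlam).2.1]; exact mul_pos hc (by linarith)) hj
  have hx : |1 / (a * lam)| - lam * (1 : ℤ) =
      -sinSeq θ (a * lam) 1 (1 + 1) / sinSeq θ (a * lam) 1 1 := by
    rw [abs_of_pos (by positivity), sinSeq_add_two, ← hlam, zero_add, sinSeq_one, sinSeq_zero]
    push_cast
    field_simp
    ring
  have c₁ : (a - 1) * lam ≤ |1 / (a * lam)| - lam * (1 : ℤ) := by
    rw [abs_of_pos (by positivity)]
    have : a * lam ≤ 1 / (a * lam) := by rw [le_div_iff₀ hal0]; nlinarith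
    push_cast; linarith
  have c₂ : |1 / (a * lam)| - lam * (1 : ℤ) < a * lam := by
    rw [abs_of_pos (by positivity)]
    have : 1 / (a * lam) < (1 + a) * lam := by rw [div_lt_iff₀ hal0]; nlinarith
    push_cast; linarith
  have hone := rosenT_eq_of_mem hl0 hal0.ne' 1 c₁ c₂
  rw [hx] at hone c₁
  have hfirst := (rosenT_iterate_sinSeq hlam hl0 h₂ ha (A := a * lam) (B := 1) (k := 1)
    (n := h - 1) c₁ (fun j hj => hpos j (by omega))
    (by
      rw [Nat.add_sub_cancel' hh]
      exact (div_neg_of_neg_of_pos (by linarith [hpos (h + 1) le_rfl])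
        (hpos h (by omega))).trans hal0)).1
  rw [Nat.add_sub_cancel' hh] at hfirst
  have hr₂ := (sinSeq_middle_ratio hθ hlam (a * lam) 1).2
  rw [show a * lam - 1 * (lam - 1) = 1 - (1 - a) * lam by ring] at hr₂
  have b₁ : a * lam ≤ (1 - a * lam) / (1 - (1 - a) * lam) := by
    rw [le_div_iff₀ hq1]; nlinarith
  have b₂ : (1 - a * lam) / (1 - (1 - a) * lam) < (1 + a) * lam := by
    rw [div_lt_iff₀ hq1]
    linarith [mul_pos (by linarith : 0 < a - lam / 4) (by linarith : 0 < lam - 1)]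
  have htwo := rosenT_sinSeq_two (a := a) hlam hl0 (hpos h (by omega)) (hpos (h + 1) le_rfl)
    (by rw [hr₂]; exact b₁) (by rw [hr₂]; exact b₂)
  have hy : (1 - a * lam) / (1 - (1 - a) * lam) - lam =
      -(lam - (1 - a) * lam ^ 2 - 1 + a * lam) / (1 - (1 - a) * lam) := by
    rw [eq_div_iff hq1.ne', sub_mul, div_mul_cancel₀ _ hq1.ne']; ring
  rw [hr₂, hy] at htwo
  have hD : 0 < a * lam ^ 2 - 2 * lam + 2 := by linarith
  rw [show 2 * h + 1 = h + ((h - 1 + 1) + 1) by omega, Function.iterate_add_apply,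
    Function.iterate_succ_apply, hone, Function.iterate_succ_apply', hfirst, htwo,
    rosenT_iterate_block hh hθ hlam hl0 h₂ ha ((1 - 2 * a) * lam)
      (a * lam ^ 2 - 2 * lam + 2) hq1 (by ring) (by ring) hD (by rw [← hy]; linarith) ?_]
  · rw [← neg_div_neg_eq]
    ring_nf
  · rw [div_lt_iff₀ hD]
    nlinarith

/-- for odd `q = 2h+3`, `α ∈ (α₀, 1/2]`,
`T_α^{2h+1}((α−1)λ) = (1−2α)λ/((α−1)λ² + 2λ − 2)` and
`T_α^{2h+1}(αλ) = (2α−1)λ/(2λ − 2 − αλ²)`. -/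
theorem stmt12 (h q : ℕ) (hh : 1 ≤ h) (hq : q = 2 * h + 3)
    (lam : ℝ) (hlam : lam = 2 * Real.cos (Real.pi / (q : ℝ)))
    (a : ℝ)
    (ha0 : (lam - 2 + Real.sqrt (2 * lam ^ 2 - 4 * lam + 4)) / lam ^ 2 < a)
    (ha1 : a ≤ 1 / 2) :
    (rosenT lam a)^[2 * h + 1] ((a - 1) * lam) =
      (1 - 2 * a) * lam / ((a - 1) * lam ^ 2 + 2 * lam - 2) ∧
    (rosenT lam a)^[2 * h + 1] (a * lam) =
      (2 * a - 1) * lam / (2 * lam - 2 - a * lam ^ 2) := by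
  obtain ⟨h₁, h₂⟩ := two_mul_cos_pi_div_bounds hh hq hlam
  have hθ : (2 * h + 3) * (π / (q : ℝ)) = π := by
    rw [hq]; push_cast; field_simp
  exact ⟨rosenT_iterate_left_endpoint hh hθ hlam h₁ h₂ ha0 ha1,
    rosenT_iterate_right_endpoint hh hθ hlam h₁ h₂ ha0 ha1⟩
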